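/- (Lemma 1: Lyapunov decrease for the high-order tuner Slotine–Li controller.) Let n, p ∈ ℕ, θ ∈ ℝᵖ, β > 0, let Γ ∈ ℝ^{p×p} be symmetric positive definite, and let K ∈ ℝ^{n×n} satisfy zᵀ K z ≥ k ‖z‖² for all z ∈ ℝⁿ and some k > 0. Let T ∈ (0, ∞], and let M : [0, T) → ℝ^{n×n} (symmetric positive definite valued, differentiable), C : [0, T) → ℝ^{n×n}, W : [0, T) → ℝ^{n×p}, and differentiable s : [0, T) → ℝⁿ, ν, θ̂ : [0, T) → ℝᵖ satisfy, for all t ∈ [0, T): (i) the skew-symmetry property sᵀ(½ Ṁ(t) − C(t)) s = 0 for all s ∈ ℝⁿ; (ii) the sliding dynamics M(t) ṡ(t) = u(t) − W(t) θ − C(t) s(t), where u(t) := −K s(t) + W(t) θ̂(t) − (2/β) W(t) W(t)ᵀ s(t); (iii) the update laws ν′(t) = −Γ W(t)ᵀ s(t) and θ̂′(t) = β Γ (ν(t) − θ̂(t)). Define θ̃(t) := θ − ν(t), ν̃(t) := ν(t) − θ̂(t), and V(t) := ½ ( s(t)ᵀ M(t) s(t) + θ̃(t)ᵀ Γ⁻¹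 θ̃(t) + ν̃(t)ᵀ Γ⁻¹ ν̃(t) ). Then V is differentiable and V′(t) ≤ −k ‖s(t)‖² − (β/2) ‖ν̃(t)‖² for all t ∈ [0, T). -/

import Mathlib

open Matrix

/-- Lyapunov-like function
`V := ½ (sᵀ M s + (θ - ν)ᵀ Γ⁻¹ (θ - ν) + (ν - θ̂)ᵀ Γ⁻¹ (ν - θ̂))` along a trajectory. -/
noncomputable def Vfun {n p : ℕ} (θ : Fin p → ℝ) (Γ : Matrix (Fin p) (Fin p) ℝ)
    (M : ℝ → Matrix (Fin n) (Fin n) ℝ) (s : ℝ → Fin n → ℝ)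
    (ν θhat : ℝ → Fin p → ℝ) (t : ℝ) : ℝ :=
  (1 / 2) * (s t ⬝ᵥ (M t *ᵥ s t)
    + (θ - ν t) ⬝ᵥ (Γ⁻¹ *ᵥ (θ - ν t))
    + (ν t - θhat t) ⬝ᵥ (Γ⁻¹ *ᵥ (ν t - θhat t)))

theorem HasDerivAt.dotProduct_pi {n : ℕ} {x y : ℝ → Fin n → ℝ} {x' y' : Fin n → ℝ} {t : ℝ}
    (hx : HasDerivAt x x' t) (hy : HasDerivAt y y' t) :
    HasDerivAt (fun τ => x τ ⬝ᵥ y τ) (x' ⬝ᵥ y t + x t ⬝ᵥ y') t := by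
  simp only [dotProduct, ← Finset.sum_add_distrib]
  exact HasDerivAt.fun_sum fun i _ => (hasDerivAt_pi.1 hx i).fun_mul (hasDerivAt_pi.1 hy i)

theorem HasDerivAt.mulVec_pi {m n : ℕ} {A : ℝ → Matrix (Fin m) (Fin n) ℝ}
    {A' : Matrix (Fin m) (Fin n) ℝ} {x : ℝ → Fin n → ℝ} {x' : Fin n → ℝ} {t : ℝ}
    (hA : ∀ i j, HasDerivAt (fun τ => A τ i j) (A' i j) t) (hx : HasDerivAt x x' t) :
    HasDerivAt (fun τ => A τ *ᵥ x τ) (A' *ᵥ x t + A t *ᵥ x') t :=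
  hasDerivAt_pi.2 fun i =>
    HasDerivAt.dotProduct_pi (x := fun τ => A τ i) (hasDerivAt_pi.2 (hA i)) hx

/-- Derivative of a time-varying quadratic form whose matrix is symmetric at the base point. -/
theorem HasDerivAt.quadraticForm_pi {n : ℕ} {A : ℝ → Matrix (Fin n) (Fin n) ℝ}
    {A' : Matrix (Fin n) (Fin n) ℝ} {x : ℝ → Fin n → ℝ} {x' : Fin n → ℝ} {t : ℝ}
    (hsymm : (A t).IsSymm) (hA : ∀ i j, HasDerivAt (fun τ => A τ i j) (A' i j) t)
    (hx : HasDerivAt x x' t) :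
    HasDerivAt (fun τ => x τ ⬝ᵥ (A τ *ᵥ x τ))
      (x t ⬝ᵥ (A' *ᵥ x t) + 2 * (x t ⬝ᵥ (A t *ᵥ x'))) t := by
  refine (hx.dotProduct_pi (HasDerivAt.mulVec_pi hA hx)).congr_deriv ?_
  have h : x' ⬝ᵥ (A t *ᵥ x t) = x t ⬝ᵥ (A t *ᵥ x') := by
    rw [dotProduct_mulVec, ← mulVec_transpose, hsymm.eq, dotProduct_comm]
  rw [h, dotProduct_add]
  ring

/-- Completing the square for vectors. -/
theorem neg_two_mul_dotProduct_le {p : ℕ} {β : ℝ} (hβ : 0 < β) (v w : Fin p → ℝ) :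
    -(2 * (v ⬝ᵥ w)) ≤ 2 / β * (w ⬝ᵥ w) + β / 2 * (v ⬝ᵥ v) := by
  have h : 0 ≤ ((β / 2) • v + w) ⬝ᵥ ((β / 2) • v + w) :=
    Finset.sum_nonneg fun i _ => mul_self_nonneg _
  have h' := mul_nonneg (div_pos two_pos hβ).le h
  simp only [add_dotProduct, dotProduct_add, smul_dotProduct, dotProduct_smul, smul_eq_mul,
    dotProduct_comm w v] at h'
  have e : 2 / β * (β / 2 * (β / 2 * (v ⬝ᵥ v)) + β / 2 * (v ⬝ᵥ w) + (β / 2 * (v ⬝ᵥ w) + w ⬝ᵥ w))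
      = 2 / β * (w ⬝ᵥ w) + β / 2 * (v ⬝ᵥ v) + 2 * (v ⬝ᵥ w) := by
    field_simp
    ring
  linarith

/-- Lemma 1: Lyapunov decrease for the high-order tuner Slotine–Li
controller: with the modified Slotine–Li control `u = -Ks + Wθ̂ - (2/β) W Wᵀ s`, the
sliding dynamics `M ṡ = u - W θ - C s`, the skew-symmetry property, and the high-order
tuner update laws `ν' = -Γ Wᵀ s`, `θ̂' = β Γ (ν - θ̂)`, the Lyapunov-like function `V`
is differentiable with `V' ≤ -k ‖s‖² - (β/2) ‖ν - θ̂‖²`. -/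
theorem stmt_11 {n p : ℕ} (θ : Fin p → ℝ) (β : ℝ) (hβ : 0 < β)
    (Γ : Matrix (Fin p) (Fin p) ℝ) (hΓ : Γ.PosDef)
    (K : Matrix (Fin n) (Fin n) ℝ) (k : ℝ) (hk : 0 < k)
    (hK : ∀ z : Fin n → ℝ, z ⬝ᵥ (K *ᵥ z) ≥ k * (z ⬝ᵥ z))
    (T : EReal) (hT : 0 < T)
    (M M' : ℝ → Matrix (Fin n) (Fin n) ℝ) (C : ℝ → Matrix (Fin n) (Fin n) ℝ)
    (W : ℝ → Matrix (Fin n) (Fin p) ℝ)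
    (s s' : ℝ → Fin n → ℝ) (ν θhat : ℝ → Fin p → ℝ) (u : ℝ → Fin n → ℝ)
    (hMpd : ∀ t : ℝ, 0 ≤ t → (t : EReal) < T → (M t).PosDef)
    (hMderiv : ∀ t : ℝ, 0 ≤ t → (t : EReal) < T → ∀ i j : Fin n,
      HasDerivAt (fun τ => M τ i j) (M' t i j) t)
    (hskew : ∀ t : ℝ, 0 ≤ t → (t : EReal) < T → ∀ z : Fin n → ℝ,
      z ⬝ᵥ ((((1 : ℝ) / 2) • M' t - C t) *ᵥ z) = 0)
    (hu : ∀ t : ℝ, 0 ≤ t → (t : EReal) < T →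
      u t = -(K *ᵥ s t) + W t *ᵥ θhat t - (2 / β) • (W t *ᵥ ((W t)ᵀ *ᵥ s t)))
    (hs : ∀ t : ℝ, 0 ≤ t → (t : EReal) < T → HasDerivAt s (s' t) t)
    (hsdyn : ∀ t : ℝ, 0 ≤ t → (t : EReal) < T →
      M t *ᵥ s' t = u t - W t *ᵥ θ - C t *ᵥ s t)
    (hν : ∀ t : ℝ, 0 ≤ t → (t : EReal) < T →
      HasDerivAt ν (-(Γ *ᵥ ((W t)ᵀ *ᵥ s t))) t)
    (hθhat : ∀ t : ℝ, 0 ≤ t → (t : EReal) < T →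
      HasDerivAt θhat (β • (Γ *ᵥ (ν t - θhat t))) t) :
    ∀ t : ℝ, 0 ≤ t → (t : EReal) < T →
      ∃ D : ℝ, HasDerivAt (Vfun θ Γ M s ν θhat) D t ∧
        D ≤ -k * (s t ⬝ᵥ s t) - (β / 2) * ((ν t - θhat t) ⬝ᵥ (ν t - θhat t)) := by
  intro t ht htT
  have hMs : (M t).IsSymm := by simpa using (hMpd t ht htT).isHermitian
  have hΓs : (Γ⁻¹).IsSymm := by simpa using hΓ.isHermitian.inv
  have hΓinv : ∀ z : Fin p → ℝ, Γ⁻¹ *ᵥ (Γ *ᵥ z) = z := fun z => by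
    rw [mulVec_mulVec, nonsing_inv_mul _ hΓ.det_pos.ne'.isUnit, one_mulVec]
  have hconst : ∀ i j, HasDerivAt (fun _ : ℝ => Γ⁻¹ i j) ((0 : Matrix (Fin p) (Fin p) ℝ) i j) t :=
    fun i j => hasDerivAt_const t _
  have d₁ := HasDerivAt.quadraticForm_pi hMs (hMderiv t ht htT) (hs t ht htT)
  have d₂ := HasDerivAt.quadraticForm_pi (A := fun _ => Γ⁻¹) hΓs hconst
    ((hν t ht htT).const_sub θ)
  have d₃ := HasDerivAt.quadraticForm_pi (A := fun _ => Γ⁻¹) hΓs hconst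
    ((hν t ht htT).fun_sub (hθhat t ht htT))
  refine ⟨_, ((d₁.fun_add d₂).fun_add d₃).const_mul (1 / 2), ?_⟩
  have hW : ∀ z, s t ⬝ᵥ (W t *ᵥ z) = z ⬝ᵥ ((W t)ᵀ *ᵥ s t) := fun z => by
    rw [dotProduct_mulVec, ← mulVec_transpose, dotProduct_comm]
  have hsk := hskew t ht htT (s t)
  have hKs := hK (s t)
  have hsq := neg_two_mul_dotProduct_le hβ (ν t - θhat t) ((W t)ᵀ *ᵥ s t)
  rw [hsdyn t ht htT, hu t ht htT]
  simp only [sub_mulVec, smul_mulVec, dotProduct_sub, dotProduct_smul, smul_eq_mul] at hsk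
  simp only [neg_neg, mulVec_sub, mulVec_neg, mulVec_smul, hΓinv, zero_mulVec, dotProduct_zero,
    dotProduct_sub, dotProduct_add, dotProduct_neg, dotProduct_smul, smul_eq_mul, hW,
    sub_dotProduct] at hsq ⊢
  linarith
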